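/- Let G be a finite simple graph with vertex set V and edge set E, and let B be its V×E incidence matrix (B_{ve} = 1 if v is an endpoint of e, and 0 otherwise). Let A be a unital C*-algebra, let w be a magic unitary over A indexed by V, and let u_0 be a magic unitary over A indexed by E, such that wB = Bu_0 and u_0 Bᵗ = Bᵗ w. Then for every edge (a,b) ∈ E and all v,s ∈ V such that (v,s) is not an edge of G, one has w_{va} w_{sb} = 0 and w_{av} w_{bs} = 0. -/

import Mathlib

open scoped BigOperators

/-- A magic unitary over a ring with star: every entry is a projection and
every row and column sums to `1`. -/
def IsMagicUnitary {I J A : Type*} [Fintype I] [Fintype J] [Ring A] [StarRing A]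
    (u : I → J → A) : Prop :=
  (∀ i j, star (u i j) = u i j) ∧ (∀ i j, u i j * u i j = u i j) ∧
    (∀ i, ∑ j, u i j = 1) ∧ (∀ j, ∑ i, u i j = 1)

open scoped ENNReal in
theorem IsSelfAdjoint.eq_zero_of_spectrum_subset {A : Type*} [NormedRing A] [StarRing A]
    [CStarRing A] [NormedAlgebra ℂ A] [CompleteSpace A] {z : A} (hz : IsSelfAdjoint z)
    (h : ∀ c ∈ spectrum ℂ z, c = 0) : z = 0 := by
  have hrad : spectralRadius ℂ z = 0 := by
    simp only [spectralRadius, ENNReal.iSup_eq_zero]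
    intro c hc
    simp [h c hc]
  have hconst : Filter.Tendsto (fun _ : ℕ => (‖z‖₊ : ℝ≥0∞)) Filter.atTop (nhds 0) := by
    rw [← hrad]
    convert! (spectrum.pow_nnnorm_pow_one_div_tendsto_nhds_spectralRadius z).comp
      (tendsto_pow_atTop_atTop_of_one_lt one_lt_two) using 1
    refine funext fun n => ?_
    rw [Function.comp_apply, hz.nnnorm_pow_two_pow, ENNReal.coe_pow, ← ENNReal.rpow_natCast,
      ← ENNReal.rpow_mul]
    simp
  simpa using tendsto_nhds_unique tendsto_const_nhds hconst

/-- A spectral bound in a corner: `z ∈ pAp` has its spectrum in the disc of radius `r` about `-r`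
as soon as `r p + z` has norm at most `r`. -/
theorem norm_add_le_of_mem_spectrum_corner {A : Type*} [NormedRing A] [NormOneClass A]
    [NormedAlgebra ℂ A] [CompleteSpace A] {p z : A} (hp : p * p = p) (hpz : p * z = z)
    (hzp : z * p = z) {r : ℝ} (hr : 0 < r) (h : ‖(r : ℂ) • p + z‖ ≤ r) {c : ℂ}
    (hc : c ∈ spectrum ℂ z) : ‖(r : ℂ) + c‖ ≤ r := by
  have hpow (n : ℕ) : (algebraMap ℂ A r + z) ^ n
      = (r : ℂ) ^ n • (1 - p) + p * ((r : ℂ) • p + z) ^ n := by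
    induction n with
    | zero => simp
    | succ n ih =>
      have hcomm : Commute p ((r : ℂ) • p + z) := by
        simp [Commute, SemiconjBy, mul_add, add_mul, hpz, hzp]
      have h₁ : (1 - p) * (algebraMap ℂ A r + z) = (r : ℂ) • (1 - p) := by
        rw [Algebra.algebraMap_eq_smul_one]
        simp [mul_add, sub_mul, hpz]
      have h₂ : p * (algebraMap ℂ A r + z) = p * ((r : ℂ) • p + z) := by
        rw [Algebra.algebraMap_eq_smul_one]
        simp [mul_add, hp]
      have h₃ : p * ((r : ℂ) • p + z) ^ n * (algebraMap ℂ A r + z)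
          = p * ((r : ℂ) • p + z) ^ (n + 1) := by
        rw [(hcomm.pow_right n).eq, mul_assoc, h₂, ← mul_assoc, ← (hcomm.pow_right n).eq,
          mul_assoc, ← pow_succ]
      rw [pow_succ, ih, add_mul, h₃, smul_mul_assoc, h₁, smul_smul, ← pow_succ]
  have hbound (n : ℕ) : (‖(r : ℂ) + c‖ / r) ^ n ≤ ‖1 - p‖ + ‖p‖ := by
    have hmem : ((r : ℂ) + c) ^ n ∈ spectrum ℂ ((algebraMap ℂ A r + z) ^ n) := by
      refine spectrum.pow_mem_pow _ _ ?_
      rw [add_comm (r : ℂ)]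
      exact spectrum.add_mem_add_iff.2 hc
    have hle := spectrum.norm_le_norm_of_mem hmem
    rw [norm_pow, hpow] at hle
    rw [div_pow, div_le_iff₀ (by positivity)]
    calc ‖(r : ℂ) + c‖ ^ n
        ≤ ‖(r : ℂ) ^ n • (1 - p)‖ + ‖p * ((r : ℂ) • p + z) ^ n‖ := hle.trans (norm_add_le _ _)
      _ ≤ r ^ n * ‖1 - p‖ + ‖p‖ * r ^ n := by
          gcongr
          · simp [norm_smul, abs_of_pos hr]
          · exact (norm_mul_le _ _).trans (by
              gcongr
              exact (norm_pow_le _ n).trans (by gcongr))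
      _ = (‖1 - p‖ + ‖p‖) * r ^ n := by ring
  by_contra! hlt
  obtain ⟨n, hn⟩ := pow_unbounded_of_one_lt (‖1 - p‖ + ‖p‖) ((one_lt_div hr).2 hlt)
  exact (hn.trans_le (hbound n)).false

theorem Complex.eq_zero_of_norm_add_le_of_norm_sub_le {r : ℝ} {c : ℂ} (h₁ : ‖(r : ℂ) + c‖ ≤ r)
    (h₂ : ‖(r : ℂ) - c‖ ≤ r) : c = 0 := by
  have hpar := parallelogram_law_with_norm ℝ (r : ℂ) c
  have hr : ‖(r : ℂ)‖ = r := by simpa using (norm_nonneg _).trans h₁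
  rw [hr] at hpar
  have h₃ := mul_self_le_mul_self (norm_nonneg _) h₁
  have h₄ := mul_self_le_mul_self (norm_nonneg _) h₂
  exact norm_eq_zero.1 (mul_self_eq_zero.1 (by nlinarith [mul_self_nonneg ‖c‖]))

/-- Projections with sum `1` are pairwise orthogonal. The involution is not assumed to be
conjugate-linear, so positivity is replaced by norm estimates in the corner of `p i`. -/
theorem IsStarProjection.mul_eq_zero_of_sum_eq_one {ι A : Type*} [Fintype ι] [NormedRing A]
    [StarRing A] [CStarRing A] [NormedAlgebra ℂ A] [CompleteSpace A] {p : ι → A}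
    (hp : ∀ i, IsStarProjection (p i)) (hsum : ∑ i, p i = 1) {i j : ι} (hij : i ≠ j) :
    p i * p j = 0 := by
  classical
  nontriviality A
  have hidem (k : ι) : p k * p k = p k := (hp k).isIdempotentElem
  have hstar (k : ι) : star (p k) = p k := (hp k).isSelfAdjoint
  have hidem' (k : ι) (x : A) : p k * (p k * x) = p k * x := by rw [← mul_assoc, hidem]
  have hnorm : ‖p i‖ ≤ 1 := by
    have h := CStarRing.norm_star_mul_self (x := p i)
    rw [hstar, hidem] at h
    nlinarith [norm_nonneg (p i)]
  have hreflection (k : ι) : ‖p i - 2 * (p i * p k * p i)‖ ≤ 1 := by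
    have hunit : ‖1 - 2 * p k‖ = 1 := by
      refine CStarRing.norm_of_mem_unitary ?_
      have hs : star (1 - 2 * p k) = 1 - 2 * p k := by simp [two_mul, hstar]
      have hsq : (1 - 2 * p k) * (1 - 2 * p k) = 1 := by
        simp only [two_mul, mul_sub, sub_mul, mul_add, add_mul, hidem, mul_one, one_mul]
        abel
      exact Unitary.mem_iff.2 ⟨by rw [hs, hsq], by rw [hs, hsq]⟩
    calc ‖p i - 2 * (p i * p k * p i)‖ = ‖p i * (1 - 2 * p k) * p i‖ := by
          congr 1
          simp only [two_mul, mul_sub, sub_mul, mul_add, add_mul, hidem, mul_one]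
      _ ≤ ‖p i‖ * ‖1 - 2 * p k‖ * ‖p i‖ := norm_mul₃_le
      _ ≤ 1 := by
          rw [hunit]
          nlinarith [norm_nonneg (p i)]
  set z : A := 2 * (p i * p j * p i) with hz
  set S : Finset ι := (Finset.univ.erase i).erase j with hS
  have hcompression : ∑ k ∈ S, p i * p k * p i + p i * p j * p i = 0 := by
    rw [hS, Finset.sum_erase_add _ _ (by simp [hij.symm]), ← Finset.sum_mul, ← Finset.mul_sum,
      ← sub_eq_of_eq_add (Finset.sum_erase_add Finset.univ p (Finset.mem_univ i)).symm, hsum]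
    simp [mul_sub, hidem]
  set r : ℝ := S.card + 1 with hr
  have hsmul : (r : ℂ) • p i = S.card • p i + p i := by
    simp [hr, add_smul, Nat.cast_smul_eq_nsmul]
  have hplus : ‖(r : ℂ) • p i + z‖ ≤ r := by
    have heq : (r : ℂ) • p i + z = ∑ k ∈ S, (p i - 2 * (p i * p k * p i)) + p i := by
      rw [Finset.sum_sub_distrib, ← Finset.mul_sum, eq_neg_of_add_eq_zero_left hcompression, hsmul,
        Finset.sum_const, hz, mul_neg]
      abel
    rw [heq]
    refine (norm_add_le _ _).trans (add_le_add ?_ hnorm)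
    exact (norm_sum_le_of_le S fun k _ => hreflection k).trans (by simp)
  have hminus : ‖(r : ℂ) • p i + -z‖ ≤ r := by
    have heq : (r : ℂ) • p i + -z = ∑ _k ∈ S, p i + (p i - z) := by
      rw [hsmul, Finset.sum_const]
      abel
    rw [heq]
    refine (norm_add_le _ _).trans (add_le_add ?_ (hreflection j))
    exact (norm_sum_le_of_le S fun _ _ => hnorm).trans (by simp)
  have hpz : p i * z = z := by simp only [hz, two_mul, mul_add, mul_assoc, hidem']
  have hzp : z * p i = z := by simp only [hz, two_mul, add_mul, mul_assoc, hidem]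
  have hr0 : 0 < r := by positivity
  have hzero : z = 0 := by
    refine IsSelfAdjoint.eq_zero_of_spectrum_subset ?_ fun c hc => ?_
    · simp [IsSelfAdjoint, hz, two_mul, hstar, mul_assoc]
    · refine Complex.eq_zero_of_norm_add_le_of_norm_sub_le
        (norm_add_le_of_mem_spectrum_corner (hidem i) hpz hzp hr0 hplus hc) ?_
      rw [sub_eq_add_neg]
      refine norm_add_le_of_mem_spectrum_corner (hidem i) (by simp [hpz]) (by simp [hzp]) hr0
        hminus ?_
      rwa [← spectrum.neg_eq, Set.neg_mem_neg]
  have htwo : (2 : ℂ) • (p i * p j * p i) = 0 := by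
    rw [← hzero, hz, two_smul, two_mul]
  rw [← CStarRing.mul_star_self_eq_zero_iff, star_mul, hstar, hstar, mul_assoc, hidem',
    ← mul_assoc]
  exact (smul_eq_zero.1 htwo).resolve_left two_ne_zero

theorem SimpleGraph.sum_mem_edge {V A : Type*} [Fintype V] [DecidableEq V] [AddCommMonoid A]
    (G : SimpleGraph V) {a b : V} (hab : G.Adj a b) (f : V → A) :
    (∑ x, if x ∈ s(a, b) then f x else 0) = f a + f b := by
  rw [← Finset.sum_filter, ← Finset.sum_pair hab.ne]
  congr 1
  ext x
  simp

/-- The algebraic core of the intertwiner argument, for families with orthogonal columns. -/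
theorem SimpleGraph.mul_eq_zero_of_incidence_intertwiner {V A : Type*} [Fintype V] [DecidableEq V]
    [Ring A] (G : SimpleGraph V) [DecidableRel G.Adj] {w : V → V → A}
    {u : G.edgeSet → G.edgeSet → A}
    (hidem : ∀ v a, w v a * w v a = w v a)
    (hrow : ∀ v a b, a ≠ b → w v a * w v b = 0)
    (hcol : ∀ v s a, v ≠ s → w v a * w s a = 0)
    (hu : ∀ e f g, f ≠ g → u f e * u g e = 0)
    (hB : ∀ (v : V) (e : G.edgeSet), (∑ x, if x ∈ (e : Sym2 V) then w v x else 0)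
      = ∑ f : G.edgeSet, if v ∈ (f : Sym2 V) then u f e else 0)
    {a b v s : V} (hab : G.Adj a b) (hvs : ¬ G.Adj v s) : w v a * w s b = 0 := by
  obtain rfl | hne := eq_or_ne v s
  · exact hrow v a b hab.ne
  have hsum (x : V) : w x a + w x b
      = ∑ f : G.edgeSet, if x ∈ (f : Sym2 V) then u f ⟨s(a, b), hab⟩ else 0 := by
    rw [← hB x ⟨s(a, b), hab⟩, G.sum_mem_edge hab]
  have hprod : (w v a + w v b) * (w s a + w s b) = 0 := by
    rw [hsum, hsum, Finset.sum_mul_sum]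
    refine Finset.sum_eq_zero fun f _ => Finset.sum_eq_zero fun g _ => ?_
    by_cases hf : v ∈ (f : Sym2 V)
    · by_cases hg : s ∈ (g : Sym2 V)
      · obtain rfl | hfg := eq_or_ne f g
        · have h := f.2
          rw [(Sym2.mem_and_mem_iff hne).1 ⟨hf, hg⟩] at h
          exact absurd h hvs
        · simp [hf, hg, hu _ _ _ hfg]
      · simp [hg]
    · simp [hf]
  have h := congrArg (w v a * ·) hprod
  simpa [mul_add, add_mul, hcol _ _ _ hne, ← mul_assoc, hidem, hrow _ _ _ hab.ne] using h

/-- If `w` (indexed by vertices) and `u₀` (indexed by edges) are magic unitaries that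
intertwine the incidence matrix `B` of a finite simple graph (`wB = Bu₀` and
`u₀Bᵗ = Bᵗw`), then for every edge `(a,b)` and every non-adjacent pair `(v,s)` one has
`w_{va} w_{sb} = 0` and `w_{av} w_{bs} = 0`. -/
theorem incidenceIntertwinerOrthogonality
    {V A : Type*} [Fintype V] [DecidableEq V]
    [NormedRing A] [StarRing A] [CStarRing A] [NormedAlgebra ℂ A] [CompleteSpace A]
    (G : SimpleGraph V) [DecidableRel G.Adj]
    (w : V → V → A) (hw : IsMagicUnitary w)
    (u₀ : G.edgeSet → G.edgeSet → A) (hu₀ : IsMagicUnitary u₀)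
    (hBrow : ∀ (v : V) (e : G.edgeSet),
      (∑ x, w v x * (if x ∈ (e : Sym2 V) then (1 : A) else 0))
        = ∑ f : G.edgeSet, (if v ∈ (f : Sym2 V) then (1 : A) else 0) * u₀ f e)
    (hBcol : ∀ (e : G.edgeSet) (v : V),
      (∑ f : G.edgeSet, u₀ e f * (if v ∈ (f : Sym2 V) then (1 : A) else 0))
        = ∑ x, (if x ∈ (e : Sym2 V) then (1 : A) else 0) * w x v) :
    ∀ a b v s : V, G.Adj a b → ¬ G.Adj v s →
      w v a * w s b = 0 ∧ w a v * w b s = 0 := by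
  obtain ⟨hws, hwi, hwr, hwc⟩ := hw
  obtain ⟨hus, hui, hur, huc⟩ := hu₀
  have hwrow (v a b : V) (h : a ≠ b) : w v a * w v b = 0 :=
    IsStarProjection.mul_eq_zero_of_sum_eq_one (fun x => ⟨hwi v x, hws v x⟩) (hwr v) h
  have hwcol (v s a : V) (h : v ≠ s) : w v a * w s a = 0 :=
    IsStarProjection.mul_eq_zero_of_sum_eq_one (p := fun x => w x a)
      (fun x => ⟨hwi x a, hws x a⟩) (hwc a) h
  have hurow (e f g : G.edgeSet) (h : f ≠ g) : u₀ e f * u₀ e g = 0 :=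
    IsStarProjection.mul_eq_zero_of_sum_eq_one (fun x => ⟨hui e x, hus e x⟩) (hur e) h
  have hucol (e f g : G.edgeSet) (h : f ≠ g) : u₀ f e * u₀ g e = 0 :=
    IsStarProjection.mul_eq_zero_of_sum_eq_one (p := fun x => u₀ x e)
      (fun x => ⟨hui x e, hus x e⟩) (huc e) h
  intro a b v s hab hvs
  refine ⟨G.mul_eq_zero_of_incidence_intertwiner hwi hwrow hwcol hucol
    (fun v e => by simpa using hBrow v e) hab hvs, ?_⟩
  exact G.mul_eq_zero_of_incidence_intertwiner (w := fun x y => w y x) (u := fun e f => u₀ f e)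
    (fun v a => hwi a v) (fun v a b => hwcol a b v) (fun v s a => hwrow a v s) hurow
    (fun v e => by simpa using (hBcol e v).symm) hab hvs
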